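/- arXiv:1110.6346 — 9 statements merged into one kernel-verified Lean document; each statement's English description precedes it below -/
import Mathlib

section
/- Let q be an odd prime and F = ℤ/qℤ. The congruence orbit {GᵀHG : G ∈ GL₂(F)} of the matrix H = [[0,1],[1,0]] under GL₂(F) has exactly q(q²-1)/2 elements. -/
open Matrix

/-- The right action of `GL n R` on square matrices by congruence, `T ↦ Gᵀ * T * G`. -/
@[reducible] def congruenceAction (n R : Type*) [Fintype n] [DecidableEq n] [CommRing R] :
    MulAction (GL n R)ᵐᵒᵖ (Matrix n n R) where
  smul G T := (G.unop : Matrix n n R)ᵀ * T * (G.unop : Matrix n n R)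
  one_smul T := by
    change ((1 : GL n R) : Matrix n n R)ᵀ * T * ((1 : GL n R) : Matrix n n R) = T
    simp
  mul_smul G G₂ T := by
    change ((G₂.unop * G.unop : GL n R) : Matrix n n R)ᵀ * T *
      ((G₂.unop * G.unop : GL n R) : Matrix n n R) =
      (G.unop : Matrix n n R)ᵀ * ((G₂.unop : Matrix n n R)ᵀ * T * (G₂.unop : Matrix n n R)) *
        (G.unop : Matrix n n R)
    simp [Matrix.mul_assoc]

section HyperbolicPlane

variable {K : Type*} [Field K]

/-- The entrywise description of the isometries of the hyperbolic plane. -/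
theorem transpose_mul_hyperbolic_mul_eq_iff (h2 : (2 : K) ≠ 0) (A : Matrix (Fin 2) (Fin 2) K) :
    Aᵀ * !![0, 1; 1, 0] * A = !![0, 1; 1, 0] ↔
      (A 0 1 = 0 ∧ A 1 0 = 0 ∧ A 0 0 * A 1 1 = 1) ∨
        (A 0 0 = 0 ∧ A 1 1 = 0 ∧ A 0 1 * A 1 0 = 1) := by
  have key : Aᵀ * !![0, 1; 1, 0] * A = !![0, 1; 1, 0] ↔
      2 * (A 0 0 * A 1 0) = 0 ∧ 2 * (A 0 1 * A 1 1) = 0 ∧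
        A 0 0 * A 1 1 + A 0 1 * A 1 0 = 1 := by
    rw [← Matrix.ext_iff]
    simp only [Fin.forall_fin_two, Matrix.mul_apply, Fin.sum_univ_two, Matrix.transpose_apply,
      Matrix.of_apply, Matrix.cons_val', Matrix.cons_val_zero, Matrix.cons_val_one,
      Matrix.cons_val_fin_one]
    constructor
    · rintro ⟨⟨h, h₂⟩, -, h₃⟩
      exact ⟨by linear_combination h, by linear_combination h₃, by linear_combination h₂⟩
    · rintro ⟨h, h₂, h₃⟩
      exact ⟨⟨by linear_combination h, by linear_combination h₃⟩,
        by linear_combination h₃, by linear_combination h₂⟩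
  rw [key]
  simp only [mul_eq_zero, h2, false_or]
  constructor
  · rintro ⟨h | h, h₂ | h₂, h₃⟩ <;> simp_all
  · rintro (⟨h, h₂, h₃⟩ | ⟨h, h₂, h₃⟩) <;> simp_all

/-- A diagonal or antidiagonal isometry of the hyperbolic plane, with the given unit as its
entry in the first row. -/
def hyperbolicIsometry : Kˣ ⊕ Kˣ → GL (Fin 2) K
  | .inl u => ⟨!![(u : K), 0; 0, (u⁻¹ : Kˣ)], !![((u⁻¹ : Kˣ) : K), 0; 0, u],
      by simp [Matrix.one_fin_two], by simp [Matrix.one_fin_two]⟩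
  | .inr u => ⟨!![0, (u : K); (u⁻¹ : Kˣ), 0], !![0, (u : K); (u⁻¹ : Kˣ), 0],
      by simp [Matrix.one_fin_two], by simp [Matrix.one_fin_two]⟩

theorem hyperbolicIsometry_injective :
    Function.Injective (hyperbolicIsometry : Kˣ ⊕ Kˣ → GL (Fin 2) K) := by
  intro x y h
  have h0 := congrArg (fun G : GL (Fin 2) K => (G : Matrix (Fin 2) (Fin 2) K) 0 0) h
  have h1 := congrArg (fun G : GL (Fin 2) K => (G : Matrix (Fin 2) (Fin 2) K) 0 1) h
  rcases x with u | u <;> rcases y with v | v <;>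
    simp_all [hyperbolicIsometry, Units.ext_iff]

theorem range_hyperbolicIsometry (h2 : (2 : K) ≠ 0) :
    Set.range (hyperbolicIsometry : Kˣ ⊕ Kˣ → GL (Fin 2) K) =
      {G : GL (Fin 2) K | (G : Matrix (Fin 2) (Fin 2) K)ᵀ * !![0, 1; 1, 0] *
        (G : Matrix (Fin 2) (Fin 2) K) = !![0, 1; 1, 0]} := by
  ext G
  rw [Set.mem_ofPred_eq, transpose_mul_hyperbolic_mul_eq_iff h2]
  constructor
  · rintro ⟨u | u, rfl⟩ <;> simp [hyperbolicIsometry]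
  · rintro (⟨h, h₂, h₃⟩ | ⟨h, h₂, h₃⟩)
    · refine ⟨.inl (Units.mkOfMulEqOne _ _ h₃), Units.ext ?_⟩
      ext i j
      fin_cases i <;> fin_cases j <;>
        simp [hyperbolicIsometry, h, h₂, eq_inv_of_mul_eq_one_right h₃]
    · refine ⟨.inr (Units.mkOfMulEqOne _ _ h₃), Units.ext ?_⟩
      ext i j
      fin_cases i <;> fin_cases j <;>
        simp [hyperbolicIsometry, h, h₂, eq_inv_of_mul_eq_one_right h₃]

theorem card_hyperbolic_isometries [Finite K] (h2 : (2 : K) ≠ 0) :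
    Nat.card {G : GL (Fin 2) K | (G : Matrix (Fin 2) (Fin 2) K)ᵀ * !![0, 1; 1, 0] *
      (G : Matrix (Fin 2) (Fin 2) K) = !![0, 1; 1, 0]} = 2 * (Nat.card K - 1) := by
  rw [← range_hyperbolicIsometry h2, Nat.card_range_of_injective hyperbolicIsometry_injective,
    Nat.card_sum, Nat.card_units, two_mul]

theorem ncard_hyperbolic_orbit_mul [Finite K] (h2 : (2 : K) ≠ 0) :
    2 * (Nat.card K - 1) * Set.ncard {T : Matrix (Fin 2) (Fin 2) K | ∃ G : GL (Fin 2) K,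
      T = (G : Matrix (Fin 2) (Fin 2) K)ᵀ * !![0, 1; 1, 0] *
        (G : Matrix (Fin 2) (Fin 2) K)} = Nat.card (GL (Fin 2) K) := by
  let := congruenceAction (Fin 2) K
  let H : Matrix (Fin 2) (Fin 2) K := !![0, 1; 1, 0]
  have orbit_eq : {T : Matrix (Fin 2) (Fin 2) K | ∃ G : GL (Fin 2) K,
      T = (G : Matrix (Fin 2) (Fin 2) K)ᵀ * !![0, 1; 1, 0] * (G : Matrix (Fin 2) (Fin 2) K)} =
      MulAction.orbit (GL (Fin 2) K)ᵐᵒᵖ H := by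
    ext T
    constructor
    · rintro ⟨G, rfl⟩
      exact ⟨MulOpposite.op G, rfl⟩
    · rintro ⟨G, rfl⟩
      exact ⟨G.unop, rfl⟩
  have card_stabilizer : Nat.card (MulAction.stabilizer (GL (Fin 2) K)ᵐᵒᵖ H) =
      2 * (Nat.card K - 1) := by
    rw [← card_hyperbolic_isometries h2]
    exact Nat.card_congr (MulOpposite.opEquiv.symm.subtypeEquiv fun _ => Iff.rfl)
  rw [orbit_eq, ← MulAction.index_stabilizer, ← card_stabilizer, Subgroup.card_mul_index]
  exact Nat.card_congr MulOpposite.opEquiv.symm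

end HyperbolicPlane

/-- The congruence orbit of the hyperbolic plane matrix `H = !![0,1;1,0]` under
`GL₂(ℤ/qℤ)` has exactly `q(q²-1)/2` elements, for `q` an odd prime. -/
theorem hyperbolic_orbit_card (q : ℕ) (hq : q.Prime) (hodd : Odd q) :
    Set.ncard {T : Matrix (Fin 2) (Fin 2) (ZMod q) |
      ∃ G : GL (Fin 2) (ZMod q),
        T = (G : Matrix (Fin 2) (Fin 2) (ZMod q))ᵀ * !![0, 1; 1, 0] *
          (G : Matrix (Fin 2) (Fin 2) (ZMod q))} = q * (q ^ 2 - 1) / 2 := by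
  have : Fact q.Prime := ⟨hq⟩
  have h2 : (2 : ZMod q) ≠ 0 := by
    refine Ring.two_ne_zero ?_
    rw [ZMod.ringChar_zmod_n]
    rintro rfl
    exact absurd hodd (by decide)
  have h := ncard_hyperbolic_orbit_mul h2
  rw [Matrix.card_GL_field, Fin.prod_univ_two, Nat.card_zmod, ZMod.card] at h
  have hfactor : q ^ 2 - q = (q - 1) * q := by rw [Nat.sub_mul, one_mul, sq]
  refine (Nat.div_eq_of_eq_mul_right two_pos ?_).symm
  refine Nat.eq_of_mul_eq_mul_left (Nat.sub_pos_of_lt hq.one_lt) ?_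
  simp only [Fin.val_zero, Fin.val_one, pow_zero, pow_one, hfactor] at h
  linear_combination -h
end

section
/- Let q be an odd prime and F = ℤ/qℤ. For every nonzero a ∈ F, exactly q(q-1)/2 matrices in the congruence orbit {GᵀHG : G ∈ GL₂(F)} of H = [[0,1],[1,0]] have (1,1)-entry equal to a. -/
open Matrix

/-- A binary quadratic form `!![a, b; b, c]` with `a ≠ 0` over a field of characteristic not two
is congruent to the hyperbolic plane as soon as `b² - ac` is a nonzero square. -/
theorem exists_congr_hyperbolic {F : Type*} [Field F] (h2 : (2 : F) ≠ 0) {a b c d : F}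
    (ha : a ≠ 0) (hd : d ≠ 0) (h : b ^ 2 - a * c = d ^ 2) :
    ∃ G : GL (Fin 2) F, !![a, b; b, c] =
      (G : Matrix (Fin 2) (Fin 2) F)ᵀ * !![0, 1; 1, 0] * (G : Matrix (Fin 2) (Fin 2) F) := by
  have hdet : (!![1, (b + d) / a; a / 2, (b - d) / 2] : Matrix (Fin 2) (Fin 2) F).det ≠ 0 := by
    rw [det_fin_two_of]
    convert neg_ne_zero.mpr hd using 1
    field_simp
    ring
  refine ⟨GeneralLinearGroup.mkOfDetNeZero _ hdet, ?_⟩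
  have hc : c = (b ^ 2 - d ^ 2) / a := by
    rw [eq_div_iff ha]
    linear_combination -h
  subst hc
  ext i j
  fin_cases i <;> fin_cases j <;>
    simp [GeneralLinearGroup.mkOfDetNeZero, mul_apply, Fin.sum_univ_two] <;> field_simp <;> ring

/-- The symmetric matrices in the congruence orbit of the hyperbolic plane with given nonzero
upper left entry `a`, parametrized by the off-diagonal entry and minus the determinant. -/
theorem hyperbolic_orbit_entry_eq_range {F : Type*} [Field F] (h2 : (2 : F) ≠ 0) {a : F}
    (ha : a ≠ 0) :
    {T : Matrix (Fin 2) (Fin 2) F |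
      (∃ G : GL (Fin 2) F, T = (G : Matrix (Fin 2) (Fin 2) F)ᵀ * !![0, 1; 1, 0] *
        (G : Matrix (Fin 2) (Fin 2) F)) ∧ T 0 0 = a} =
      Set.range fun p : F × (powMonoidHom 2 : Fˣ →* Fˣ).range =>
        !![a, p.1; p.1, (p.1 ^ 2 - ((p.2 : Fˣ) : F)) / a] := by
  ext T
  constructor
  · rintro ⟨⟨G, hT⟩, rfl⟩
    refine ⟨⟨T 0 1, ⟨_, GeneralLinearGroup.det G, rfl⟩⟩, ?_⟩
    subst hT
    ext i j
    fin_cases i <;> fin_cases j <;>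
      simp [mul_apply, Fin.sum_univ_two, det_fin_two] at ha ⊢
    · ring
    · rw [div_eq_iff ha]
      ring
  · rintro ⟨⟨b, _, d, rfl⟩, rfl⟩
    refine ⟨exists_congr_hyperbolic h2 ha d.ne_zero ?_, rfl⟩
    simp [mul_div_cancel₀ _ ha]

/-- For `a ≠ 0` in `ℤ/qℤ` (`q` an odd prime), exactly `q(q-1)/2` matrices in the
congruence orbit of `H = !![0,1;1,0]` under `GL₂(ℤ/qℤ)` have `(1,1)`-entry `a`. -/
theorem hyperbolic_orbit_entry_card (q : ℕ) (hq : q.Prime) (hodd : Odd q)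
    (a : ZMod q) (ha : a ≠ 0) :
    Set.ncard {T : Matrix (Fin 2) (Fin 2) (ZMod q) |
      (∃ G : GL (Fin 2) (ZMod q),
        T = (G : Matrix (Fin 2) (Fin 2) (ZMod q))ᵀ * !![0, 1; 1, 0] *
          (G : Matrix (Fin 2) (Fin 2) (ZMod q))) ∧ T 0 0 = a} = q * (q - 1) / 2 := by
  have : Fact q.Prime := ⟨hq⟩
  have h2 : (2 : ZMod q) ≠ 0 :=
    Ring.two_ne_zero (by rw [ZMod.ringChar_zmod_n]; rintro rfl; exact absurd hodd (by decide))
  have heven : 2 ∣ q - 1 := (Nat.Odd.sub_odd hodd odd_one).two_dvd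
  rw [hyperbolic_orbit_entry_eq_range h2 ha, ← Nat.card_coe_set_eq, Nat.card_range_of_injective,
    Nat.card_prod, IsCyclic.card_powMonoidHom_range, Nat.card_zmod, Nat.card_eq_fintype_card,
    ZMod.card_units, Nat.gcd_eq_right heven, Nat.mul_div_assoc _ heven]
  rintro ⟨b, s⟩ ⟨b', s'⟩ h
  obtain rfl : b = b' := congrFun₂ h 0 1
  have h11 : (b ^ 2 - ((s : (ZMod q)ˣ) : ZMod q)) / a = (b ^ 2 - ((s' : (ZMod q)ˣ) : ZMod q)) / a :=
    congrFun₂ h 1 1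
  rw [div_left_inj' ha, sub_right_inj, Units.val_inj, Subtype.val_inj] at h11
  rw [h11]
end

section
/- Let q be an odd prime and F = ℤ/qℤ. Exactly q(q-1) matrices in the congruence orbit {GᵀHG : G ∈ GL₂(F)} of H = [[0,1],[1,0]] have (1,1)-entry equal to 0. -/
open Matrix

/-- Over a field of characteristic other than two, the matrices congruent to the hyperbolic plane
whose upper left entry vanishes are exactly the `!![0, b; b, c]` with `b` a unit. -/
theorem hyperbolic_orbit_zero_entry_eq_range {K : Type*} [Field K] (h2 : (2 : K) ≠ 0) :
    {T : Matrix (Fin 2) (Fin 2) K |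
      (∃ G : GL (Fin 2) K, T = (G : Matrix (Fin 2) (Fin 2) K)ᵀ * !![0, 1; 1, 0] *
        (G : Matrix (Fin 2) (Fin 2) K)) ∧ T 0 0 = 0} =
      Set.range fun p : Kˣ × K => !![0, (p.1 : K); (p.1 : K), p.2] := by
  ext T
  constructor
  · rintro ⟨⟨G, hT⟩, h00⟩
    have hdet : T.det ≠ 0 := by
      have hG : (G : Matrix (Fin 2) (Fin 2) K).det ≠ 0 :=
        ((Matrix.isUnit_iff_isUnit_det _).1 G.isUnit).ne_zero
      simp [hT, hG]
    have hsymm : T 1 0 = T 0 1 := by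
      simp only [hT, Matrix.mul_apply, Fin.sum_univ_two]
      simp
      ring
    have h01 : T 0 1 ≠ 0 := by
      rintro h
      simp [Matrix.det_fin_two, h00, h] at hdet
    refine ⟨(Units.mk0 _ h01, T 1 1), ?_⟩
    ext i j
    fin_cases i <;> fin_cases j <;> simp [h00, hsymm]
  · rintro ⟨⟨b, c⟩, rfl⟩
    have hb : (b : K) ≠ 0 := b.ne_zero
    refine ⟨⟨GeneralLinearGroup.mkOfDetNeZero !![1, c / (2 * b); 0, (b : K)]
      (by simp [Matrix.det_fin_two]), ?_⟩, by simp⟩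
    ext i j
    fin_cases i <;> fin_cases j <;>
      simp [GeneralLinearGroup.mkOfDetNeZero, Matrix.mul_apply, Fin.sum_univ_two]
    field_simp
    ring

/-- For `q` an odd prime, exactly `q(q-1)` matrices in the congruence orbit of
`H = !![0,1;1,0]` under `GL₂(ℤ/qℤ)` have `(1,1)`-entry `0`. -/
theorem hyperbolic_orbit_zero_entry_card (q : ℕ) (hq : q.Prime) (hodd : Odd q) :
    Set.ncard {T : Matrix (Fin 2) (Fin 2) (ZMod q) |
      (∃ G : GL (Fin 2) (ZMod q),
        T = (G : Matrix (Fin 2) (Fin 2) (ZMod q))ᵀ * !![0, 1; 1, 0] *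
          (G : Matrix (Fin 2) (Fin 2) (ZMod q))) ∧ T 0 0 = 0} = q * (q - 1) := by
  have : Fact q.Prime := ⟨hq⟩
  have h2 : (2 : ZMod q) ≠ 0 := by
    apply Ring.two_ne_zero
    rw [ZMod.ringChar_zmod_n]
    rintro rfl
    exact absurd hodd (by decide)
  have hinj : Function.Injective
      fun p : (ZMod q)ˣ × ZMod q => !![0, (p.1 : ZMod q); (p.1 : ZMod q), p.2] := by
    rintro ⟨b, c⟩ ⟨b', c'⟩ h
    have hb := congrFun (congrFun h 0) 1
    have hc := congrFun (congrFun h 1) 1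
    exact Prod.ext (Units.ext (by simpa using hb)) (by simpa using hc)
  rw [hyperbolic_orbit_zero_entry_eq_range h2, ← Set.image_univ,
    Set.ncard_image_of_injective _ hinj, Set.ncard_univ, Nat.card_prod, Nat.card_eq_fintype_card,
    ZMod.card_units, Nat.card_zmod, mul_comm]
end

section
/- Let q be an odd prime, F = ℤ/qℤ, and ω a non-square unit of F. The congruence orbit {GᵀAG : G ∈ GL₂(F)} of the matrix A = [[1,0],[0,-ω]] under GL₂(F) has exactly q(q-1)²/2 elements. -/
open Matrix

section AnisotropicOrbit

variable {K : Type*} [Field K]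

theorem FiniteField.exists_sq_sub_mul_sq_eq [Fintype K] (hK : Fintype.card K % 2 = 1) {ω : K}
    (hω : ω ≠ 0) (a : K) : ∃ x y : K, x ^ 2 - ω * y ^ 2 = a := by
  obtain ⟨x, y, hxy⟩ := FiniteField.exists_root_sum_quadratic
    (f := Polynomial.X ^ 2 - Polynomial.C a) (g := Polynomial.C (-ω) * Polynomial.X ^ 2)
    (Polynomial.degree_X_pow_sub_C (by decide) a)
    (Polynomial.degree_C_mul_X_pow 2 (neg_ne_zero.mpr hω)) hK
  simp only [Polynomial.eval_sub, Polynomial.eval_pow, Polynomial.eval_X, Polynomial.eval_C,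
    Polynomial.eval_mul] at hxy
  exact ⟨x, y, by linear_combination hxy⟩

/-- The symmetric matrix with upper row `(a, b)` and determinant `-ω t`. -/
def symmMatrixOfDet (ω : K) (p : Kˣ × K × (powMonoidHom 2 : Kˣ →* Kˣ).range) :
    Matrix (Fin 2) (Fin 2) K :=
  !![(p.1 : K), p.2.1; p.2.1, (p.2.1 ^ 2 - ω * ((p.2.2 : Kˣ) : K)) / (p.1 : K)]

theorem symmMatrixOfDet_injective {ω : K} (hω : ω ≠ 0) :
    Function.Injective (symmMatrixOfDet ω) := by
  rintro ⟨a, b, t, ht⟩ ⟨a', b', t', ht'⟩ h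
  have h00 := congrFun (congrFun h 0) 0
  have h01 := congrFun (congrFun h 0) 1
  have h11 := congrFun (congrFun h 1) 1
  simp only [symmMatrixOfDet, of_apply, cons_val', cons_val_zero, cons_val_one,
    cons_val_fin_one, Units.val_inj] at h00 h01 h11
  subst h00 h01
  rw [div_left_inj' a.ne_zero, sub_right_inj, mul_right_inj' hω, Units.val_inj] at h11
  subst h11
  rfl

theorem range_symmMatrixOfDet [Fintype K] (hK : Fintype.card K % 2 = 1) {ω : K}
    (hω : ¬ IsSquare ω) :
    Set.range (symmMatrixOfDet ω) = {T : Matrix (Fin 2) (Fin 2) K |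
      ∃ G : GL (Fin 2) K, T = (G : Matrix (Fin 2) (Fin 2) K)ᵀ * !![1, 0; 0, -ω] *
        (G : Matrix (Fin 2) (Fin 2) K)} := by
  have hω0 : ω ≠ 0 := by rintro rfl; exact hω .zero
  ext T
  constructor
  · rintro ⟨⟨a, b, _, s, rfl⟩, rfl⟩
    obtain ⟨x, y, hxy⟩ := FiniteField.exists_sq_sub_mul_sq_eq hK hω0 (a : K)
    have ha : (a : K) ≠ 0 := a.ne_zero
    -- The second column solves `x u - ω y v = b`, `x v - y u = s`.
    set u : K := (x * b + ω * y * s) / a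
    set v : K := (x * s + y * b) / a
    have hua : u * a = x * b + ω * y * s := div_mul_cancel₀ _ ha
    have hva : v * a = x * s + y * b := div_mul_cancel₀ _ ha
    have hdet : x * v - u * y = s := mul_right_cancel₀ ha <| by
      linear_combination x * hva - y * hua + s * hxy
    have hb : x * u - ω * y * v = b := mul_right_cancel₀ ha <| by
      linear_combination x * hua - ω * y * hva + b * hxy
    have hc : (b ^ 2 - ω * (s : K) ^ 2) / a = u ^ 2 - ω * v ^ 2 := by
      rw [div_eq_iff ha, ← hdet, ← hb, ← hxy]
      ring
    refine ⟨GeneralLinearGroup.mkOfDetNeZero !![x, u; y, v] ?_, ?_⟩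
    · rw [det_fin_two_of, hdet]
      exact s.ne_zero
    · ext i j
      fin_cases i <;> fin_cases j <;>
        simp [symmMatrixOfDet, GeneralLinearGroup.mkOfDetNeZero, Matrix.mul_apply,
          Fin.sum_univ_two, hc]
      · linear_combination -hxy
      · linear_combination -hb
      · linear_combination -hb
      · ring
  · rintro ⟨G, rfl⟩
    obtain ⟨x, u, y, v, hG⟩ : ∃ x u y v : K, (G : Matrix (Fin 2) (Fin 2) K) = !![x, u; y, v] :=
      ⟨_, _, _, _, eta_fin_two _⟩
    have hdet : x * v - u * y ≠ 0 := by
      rw [← det_fin_two_of, ← hG]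
      exact G.det_ne_zero
    have ha : x ^ 2 - ω * y ^ 2 ≠ 0 := by
      intro h
      by_cases hy : y = 0
      · have hx : x = 0 := by simpa [hy] using h
        simp [hx, hy] at hdet
      · refine hω ⟨x / y, ?_⟩
        field_simp
        linear_combination -h
    refine ⟨⟨Units.mk0 _ ha, x * u - ω * y * v, _, Units.mk0 _ hdet, rfl⟩, ?_⟩
    have hc : ((x * u - ω * y * v) ^ 2 - ω * (x * v - u * y) ^ 2) / (x ^ 2 - ω * y ^ 2) =
        u ^ 2 - ω * v ^ 2 := by
      rw [div_eq_iff ha]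
      ring
    rw [hG]
    ext i j
    fin_cases i <;> fin_cases j <;>
      simp [symmMatrixOfDet, Matrix.mul_apply, Fin.sum_univ_two, hc] <;> ring

end AnisotropicOrbit

/-- For `q` an odd prime and `ω` a non-square unit of `ℤ/qℤ`, the congruence orbit of
the anisotropic plane matrix `A = !![1,0;0,-ω]` under `GL₂(ℤ/qℤ)` has exactly
`q(q-1)²/2` elements. -/
theorem anisotropic_orbit_card (q : ℕ) (hq : q.Prime) (hodd : Odd q)
    (ω : ZMod q) (hω0 : ω ≠ 0) (hω : ¬ IsSquare ω) :
    Set.ncard {T : Matrix (Fin 2) (Fin 2) (ZMod q) |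
      ∃ G : GL (Fin 2) (ZMod q),
        T = (G : Matrix (Fin 2) (Fin 2) (ZMod q))ᵀ * !![1, 0; 0, -ω] *
          (G : Matrix (Fin 2) (Fin 2) (ZMod q))} = q * (q - 1) ^ 2 / 2 := by
  have : Fact q.Prime := ⟨hq⟩
  have hunits : Nat.card (ZMod q)ˣ = q - 1 := by
    rw [Nat.card_eq_fintype_card, ZMod.card_units]
  have heven : 2 ∣ q - 1 := (Nat.Odd.sub_odd hodd odd_one).two_dvd
  rw [← range_symmMatrixOfDet (by rw [ZMod.card]; exact Nat.odd_iff.mp hodd) hω,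
    ← Nat.card_coe_set_eq, Nat.card_range_of_injective (symmMatrixOfDet_injective hω0),
    Nat.card_prod, Nat.card_prod, IsCyclic.card_powMonoidHom_range, hunits, Nat.card_zmod,
    Nat.gcd_eq_right heven, ← mul_assoc, ← Nat.mul_div_assoc _ heven]
  congr 1
  ring
end

section
/- Let q be an odd prime, F = ℤ/qℤ, and set ε = 1 if q ≡ 1 (mod 4) and ε = -1 if q ≡ 3 (mod 4). The number of symmetric 2×2 matrices Y over F whose determinant is a nonzero square in F is exactly q(q-1)(q+ε)/2. -/
open Matrix

section QuadraticChar

variable {F : Type*} [Field F] [Fintype F] [DecidableEq F]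

/-- Twice the indicator function of the nonzero squares, via the quadratic character. -/
theorem quadraticChar_add_sq_eq_ite (x : F) :
    quadraticChar F x + quadraticChar F x ^ 2 = 2 * if x ≠ 0 ∧ IsSquare x then 1 else 0 := by
  by_cases hx : x = 0
  · simp [hx]
  · by_cases hs : IsSquare x
    · simp [hx, hs, (quadraticChar_one_iff_isSquare hx).2 hs]
    · simp [hs, quadraticChar_neg_one_iff_not_isSquare.2 hs]

theorem sum_quadraticChar_sq :
    ∑ x : F, quadraticChar F x ^ 2 = (Fintype.card F : ℤ) - 1 := by
  rw [← Finset.add_sum_erase _ _ (Finset.mem_univ (0 : F)),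
    Finset.sum_congr rfl fun x hx ↦ quadraticChar_sq_one (Finset.ne_of_mem_erase hx)]
  simp [Finset.card_erase_of_mem, Nat.cast_sub Fintype.card_pos]

theorem sum_quadraticChar_add_sq (hF : ringChar F ≠ 2) :
    ∑ x : F, (quadraticChar F x + quadraticChar F x ^ 2) = (Fintype.card F : ℤ) - 1 := by
  rw [Finset.sum_add_distrib, quadraticChar_sum_zero hF, sum_quadraticChar_sq, zero_add]

theorem sum_quadraticChar_add_sq_neg_sq :
    ∑ b : F, (quadraticChar F (-(b * b)) + quadraticChar F (-(b * b)) ^ 2) =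
      ((Fintype.card F : ℤ) - 1) * (quadraticChar F (-1) + 1) := by
  rw [← sum_quadraticChar_sq, Finset.sum_mul]
  refine Finset.sum_congr rfl fun b _ ↦ ?_
  rw [← neg_one_mul, map_mul, map_mul]
  by_cases hb : b = 0
  · simp [hb]
  · have h := quadraticChar_sq_one hb
    have h' := quadraticChar_sq_one (neg_ne_zero.2 (one_ne_zero (α := F)))
    linear_combination quadraticChar F b ^ 4 * h' + quadraticChar F b ^ 2 * h

theorem sum_quadraticChar_add_sq_det (hF : ringChar F ≠ 2) :
    ∑ a : F, ∑ b : F, ∑ c : F,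
        (quadraticChar F (a * c - b * b) + quadraticChar F (a * c - b * b) ^ 2) =
      (Fintype.card F : ℤ) * (Fintype.card F - 1) * (Fintype.card F + quadraticChar F (-1)) := by
  have h_ne : ∀ a ∈ Finset.univ.erase (0 : F), ∑ b : F, ∑ c : F,
      (quadraticChar F (a * c - b * b) + quadraticChar F (a * c - b * b) ^ 2) =
        (Fintype.card F : ℤ) * (Fintype.card F - 1) := by
    intro a ha
    have hb (b : F) : ∑ c : F,
        (quadraticChar F (a * c - b * b) + quadraticChar F (a * c - b * b) ^ 2) =
          (Fintype.card F : ℤ) - 1 := by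
      rw [← sum_quadraticChar_add_sq hF]
      exact Equiv.sum_comp
        ((Equiv.mulLeft₀ a (Finset.ne_of_mem_erase ha)).trans (Equiv.subRight (b * b)))
        fun x ↦ quadraticChar F x + quadraticChar F x ^ 2
    simp only [hb, Finset.sum_const, Finset.card_univ, nsmul_eq_mul]
  rw [← Finset.add_sum_erase _ _ (Finset.mem_univ (0 : F)), Finset.sum_congr rfl h_ne]
  simp only [zero_mul, zero_sub, Finset.sum_const, Finset.card_univ, nsmul_eq_mul,
    ← Finset.mul_sum, sum_quadraticChar_add_sq_neg_sq,
    Finset.card_erase_of_mem (Finset.mem_univ (0 : F)), Nat.cast_sub Fintype.card_pos]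
  push_cast
  ring

/-- The symmetric `2 × 2` matrices with nonzero square determinant, counted by their entries. -/
theorem ncard_symmetric_square_det :
    Set.ncard {Y : Matrix (Fin 2) (Fin 2) F | Yᵀ = Y ∧ Y.det ≠ 0 ∧ IsSquare Y.det} =
      (Finset.univ.filter fun p : F × F × F ↦
        p.1 * p.2.2 - p.2.1 * p.2.1 ≠ 0 ∧ IsSquare (p.1 * p.2.2 - p.2.1 * p.2.1)).card := by
  rw [← Set.ncard_coe_finset]
  refine Set.ncard_congr (fun Y _ ↦ (Y 0 0, Y 0 1, Y 1 1)) ?_ ?_ ?_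
  · rintro Y ⟨hY, hd⟩
    have h : Y 1 0 = Y 0 1 := congrFun₂ hY 0 1
    simpa [det_fin_two, h] using hd
  · rintro Y Z ⟨hY, -⟩ ⟨hZ, -⟩ h
    have hY' : Y 1 0 = Y 0 1 := congrFun₂ hY 0 1
    have hZ' : Z 1 0 = Z 0 1 := congrFun₂ hZ 0 1
    simp only [Prod.mk.injEq] at h
    ext i j
    fin_cases i <;> fin_cases j <;> simp [h, hY', hZ']
  · rintro ⟨a, b, c⟩ h
    refine ⟨!![a, b; b, c], ⟨?_, ?_⟩, by simp⟩
    · ext i j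
      fin_cases i <;> fin_cases j <;> rfl
    · simpa [det_fin_two] using h

theorem two_mul_ncard_symmetric_square_det (hF : ringChar F ≠ 2) :
    2 * (Set.ncard {Y : Matrix (Fin 2) (Fin 2) F |
      Yᵀ = Y ∧ Y.det ≠ 0 ∧ IsSquare Y.det} : ℤ) =
      (Fintype.card F : ℤ) * (Fintype.card F - 1) * (Fintype.card F + quadraticChar F (-1)) := by
  rw [ncard_symmetric_square_det, ← sum_quadraticChar_add_sq_det hF, Finset.card_filter,
    Nat.cast_sum, Finset.mul_sum]
  simp only [quadraticChar_add_sq_eq_ite, Fintype.sum_prod_type, Nat.cast_ite, Nat.cast_one,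
    Nat.cast_zero]

end QuadraticChar

/-- For `q` an odd prime and `ε = (-1/q)`, the number of symmetric `2×2` matrices over
`ℤ/qℤ` whose determinant is a nonzero square is `q(q-1)(q+ε)/2`. -/
theorem symmetric_square_det_count (q : ℕ) (hq : q.Prime) (hodd : Odd q)
    (ε : ℤ) (hε : ε = if q % 4 = 1 then 1 else -1) :
    (Set.ncard {Y : Matrix (Fin 2) (Fin 2) (ZMod q) |
      Yᵀ = Y ∧ Y.det ≠ 0 ∧ IsSquare Y.det} : ℤ)
      = (q : ℤ) * ((q : ℤ) - 1) * ((q : ℤ) + ε) / 2 := by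
  have : Fact q.Prime := ⟨hq⟩
  have hmod : q % 2 = 1 := Nat.odd_iff.1 hodd
  have hF : ringChar (ZMod q) ≠ 2 := by
    rw [ZMod.ringChar_zmod_n]
    rintro rfl
    omega
  have hχ : quadraticChar (ZMod q) (-1) = ε := by
    rw [quadraticChar_neg_one hF, ZMod.card, hε]
    split_ifs with h
    · exact ZMod.χ₄_nat_one_mod_four h
    · exact ZMod.χ₄_nat_three_mod_four (by omega)
  have h := two_mul_ncard_symmetric_square_det hF
  rw [hχ, ZMod.card] at h
  omega
end

section
/- Let q be an odd prime, F = ℤ/qℤ, and set ε = 1 if q ≡ 1 (mod 4) and ε = -1 if q ≡ 3 (mod 4). The number of symmetric 2×2 matrices Y over F whose determinant is a non-square (in particular nonzero) in F is exactly q(q-1)(q-ε)/2. -/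
open Matrix

section FiniteField

variable {F : Type*} [Field F]

lemma isSquare_neg_sq_iff {b : F} (hb : b ≠ 0) : IsSquare (-b ^ 2) ↔ IsSquare (-1 : F) := by
  constructor
  · rintro ⟨r, hr⟩
    refine ⟨r / b, ?_⟩
    field_simp
    linear_combination hr
  · rintro ⟨r, hr⟩
    exact ⟨r * b, by linear_combination b ^ 2 * hr⟩

variable [Fintype F]

lemma sum_mul_sub_eq_sum {M : Type*} [AddCommMonoid M] (f : F → M) {a : F} (ha : a ≠ 0) (b : F) :
    ∑ c : F, f (a * c - b) = ∑ x : F, f x :=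
  ((Equiv.mulLeft₀ a ha).trans (Equiv.subRight b)).sum_comp f

variable [DecidableEq F]

/-- The number of non-squares of a finite field `F` of odd characteristic is `(|F| - 1) / 2`. -/
lemma two_mul_sum_not_isSquare (hF : ringChar F ≠ 2) :
    2 * ∑ x : F, (if IsSquare x then 0 else 1 : ℤ) = Fintype.card F - 1 := by
  have h (x : F) : 2 * (if IsSquare x then 0 else 1 : ℤ)
      = 1 - (if x = 0 then 1 else 0) - quadraticChar F x := by
    by_cases hx : x = 0
    · simp [hx]
    · by_cases hs : IsSquare x
      · simp [hx, hs, (quadraticChar_one_iff_isSquare hx).2 hs]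
      · simp [hx, hs, quadraticChar_neg_one_iff_not_isSquare.2 hs]
  rw [Finset.mul_sum, Finset.sum_congr rfl fun x _ => h x, Finset.sum_sub_distrib,
    Finset.sum_sub_distrib, quadraticChar_sum_zero hF]
  simp

lemma sum_not_isSquare_neg_sq :
    ∑ b : F, (if IsSquare (-b ^ 2) then 0 else 1 : ℤ)
      = if IsSquare (-1 : F) then 0 else (Fintype.card F - 1 : ℤ) := by
  have h (b : F) : (if IsSquare (-b ^ 2) then 0 else 1 : ℤ)
      = if IsSquare (-1 : F) then 0 else 1 - (if b = 0 then 1 else 0) := by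
    by_cases hb : b = 0
    · simp [hb]
    · simp [hb, isSquare_neg_sq_iff hb]
  rw [Finset.sum_congr rfl fun b _ => h b]
  split_ifs <;> simp

/-- Twice the number of triples `(a, b, c)` for which `a * c - b ^ 2` is a non-square. -/
lemma two_mul_sum_not_isSquare_mul_sub_sq (hF : ringChar F ≠ 2) :
    2 * ∑ a : F, ∑ b : F, ∑ c : F, (if IsSquare (a * c - b ^ 2) then 0 else 1 : ℤ)
      = Fintype.card F * (Fintype.card F - 1)
        * (Fintype.card F - if IsSquare (-1 : F) then 1 else -1) := by
  set n : ℤ := (Fintype.card F : ℤ) with hn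
  set S : ℤ := ∑ x : F, (if IsSquare x then 0 else 1 : ℤ) with hS
  set T : ℤ := if IsSquare (-1 : F) then 0 else n - 1 with hT
  have h (a : F) : ∑ b : F, ∑ c : F, (if IsSquare (a * c - b ^ 2) then 0 else 1 : ℤ)
      = n * S + if a = 0 then n * T - n * S else 0 := by
    by_cases ha : a = 0
    · subst ha
      simp only [zero_mul, zero_sub, Finset.sum_const, Finset.card_univ, ← Finset.mul_sum,
        sum_not_isSquare_neg_sq, nsmul_eq_mul, ← hn, ← hT, if_true]
      ring
    · simp only [sum_mul_sub_eq_sum (fun x : F => (if IsSquare x then 0 else 1 : ℤ)) ha,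
        ← hS, ha, if_false, Finset.sum_const, Finset.card_univ, nsmul_eq_mul, ← hn, add_zero]
  rw [Finset.sum_congr rfl fun a _ => h a, Finset.sum_add_distrib]
  simp only [Finset.sum_const, Finset.card_univ, nsmul_eq_mul, Finset.sum_ite_eq',
    Finset.mem_univ, if_true, ← hn]
  have hS' : 2 * S = n - 1 := two_mul_sum_not_isSquare hF
  rw [hT]
  split_ifs
  · linear_combination (n * n - n) * hS'
  · linear_combination (n * n - n) * hS'

end FiniteField

/-- Symmetric `2×2` matrices are parametrised by `(a, b, c) ↦ !![a, b; b, c]`. -/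
lemma ncard_symmetric_not_isSquare_det {F : Type*} [Field F] [Fintype F] [DecidableEq F] :
    (Set.ncard {Y : Matrix (Fin 2) (Fin 2) F | Yᵀ = Y ∧ ¬ IsSquare Y.det} : ℤ)
      = ∑ a : F, ∑ b : F, ∑ c : F, (if IsSquare (a * c - b ^ 2) then 0 else 1 : ℤ) := by
  let m : F × F × F → Matrix (Fin 2) (Fin 2) F := fun t => !![t.1, t.2.1; t.2.1, t.2.2]
  have hm : Function.Injective m := by
    rintro ⟨a, b, c⟩ ⟨a', b', c'⟩ h
    have h₁ := congrFun (congrFun h 0) 0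
    have h₂ := congrFun (congrFun h 0) 1
    have h₃ := congrFun (congrFun h 1) 1
    simp_all [m]
  have himage : {Y : Matrix (Fin 2) (Fin 2) F | Yᵀ = Y ∧ ¬ IsSquare Y.det}
      = m '' ↑(Finset.univ.filter fun t : F × F × F => ¬ IsSquare (t.1 * t.2.2 - t.2.1 ^ 2)) := by
    ext Y
    simp only [Set.mem_ofPred_eq, Finset.coe_filter, Finset.mem_univ, true_and, Set.mem_image]
    constructor
    · rintro ⟨hY, hdet⟩
      have h : Y 1 0 = Y 0 1 := congrFun (congrFun hY 0) 1
      refine ⟨(Y 0 0, Y 0 1, Y 1 1), ?_, ?_⟩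
      · rwa [det_fin_two, h, ← sq] at hdet
      · ext i j
        fin_cases i <;> fin_cases j <;> simp [m, h]
    · rintro ⟨⟨a, b, c⟩, h, rfl⟩
      refine ⟨?_, ?_⟩
      · ext i j
        fin_cases i <;> fin_cases j <;> simp [m]
      · rwa [det_fin_two_of, ← sq]
  rw [himage, Set.ncard_image_of_injective _ hm, Set.ncard_coe_finset, Finset.card_filter]
  simp only [Fintype.sum_prod_type, Nat.cast_sum, ite_not, Nat.cast_ite, Nat.cast_zero,
    Nat.cast_one]

/-- For `q` an odd prime and `ε = (-1/q)`, the number of symmetric `2×2` matrices over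
`ℤ/qℤ` whose determinant is a non-square is `q(q-1)(q-ε)/2`. -/
theorem symmetric_nonsquare_det_count (q : ℕ) (hq : q.Prime) (hodd : Odd q)
    (ε : ℤ) (hε : ε = if q % 4 = 1 then 1 else -1) :
    (Set.ncard {Y : Matrix (Fin 2) (Fin 2) (ZMod q) |
      Yᵀ = Y ∧ ¬ IsSquare Y.det} : ℤ)
      = (q : ℤ) * ((q : ℤ) - 1) * ((q : ℤ) - ε) / 2 := by
  have : Fact q.Prime := ⟨hq⟩
  have hF : ringChar (ZMod q) ≠ 2 := by
    rw [ZMod.ringChar_zmod_n]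
    rintro rfl
    exact absurd hodd (by decide)
  have hiff : IsSquare (-1 : ZMod q) ↔ q % 4 = 1 := by
    rw [FiniteField.isSquare_neg_one_iff, ZMod.card]
    have := Nat.odd_iff.1 hodd
    omega
  have h := two_mul_sum_not_isSquare_mul_sub_sq hF
  simp only [ZMod.card, hiff, ← hε] at h
  rw [ncard_symmetric_not_isSquare_det, ← h, Int.mul_ediv_cancel_left _ two_ne_zero]
end

section
/- Let q be an odd prime, F = ℤ/qℤ, and ω a non-square unit of F. Among the q+1 one-dimensional subspaces of F², exactly (q+1)/2 subspaces L have the property that vᵀAv is a nonzero square in F for every nonzero v ∈ L, and exactly (q+1)/2 subspaces L have the property that vᵀAv is a non-square in F for every nonzero v ∈ L, where A = [[1,0],[0,-ω]]. -/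
open Matrix

section AnisotropicPlane

variable {F : Type*} [Field F]

lemma dotProduct_diag_mulVec (ω : F) (v : Fin 2 → F) :
    v ⬝ᵥ (!![1, 0; 0, -ω] : Matrix (Fin 2) (Fin 2) F).mulVec v = v 0 ^ 2 - ω * v 1 ^ 2 := by
  simp [dotProduct, mulVec, Fin.sum_univ_two]
  ring

lemma sq_sub_mul_sq_ne_zero {ω : F} (hω : ¬ IsSquare ω) {v : Fin 2 → F} (hv : v ≠ 0) :
    v 0 ^ 2 - ω * v 1 ^ 2 ≠ 0 := by
  intro h
  by_cases h1 : v 1 = 0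
  · have h0 : v 0 = 0 := by simpa [h1] using h
    exact hv (funext fun i => by fin_cases i <;> simp [h0, h1])
  · exact hω ⟨v 0 / v 1, by field_simp; linear_combination -h⟩

/-- Multiplication by `a + b√ω` on `F[√ω]`, in the basis `1, √ω`. -/
def mulSqrt (ω a b : F) : (Fin 2 → F) →ₗ[F] (Fin 2 → F) :=
  toLin' !![a, ω * b; b, a]

lemma norm_mulSqrt (ω a b : F) (v : Fin 2 → F) :
    mulSqrt ω a b v 0 ^ 2 - ω * mulSqrt ω a b v 1 ^ 2 =
      (a ^ 2 - ω * b ^ 2) * (v 0 ^ 2 - ω * v 1 ^ 2) := by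
  simp [mulSqrt, mulVec, dotProduct, Fin.sum_univ_two]
  ring

lemma mulSqrt_injective {ω a b : F} (hω : ¬ IsSquare ω) (h : a ^ 2 - ω * b ^ 2 ≠ 0) :
    Function.Injective (mulSqrt ω a b) := by
  rw [injective_iff_map_eq_zero]
  intro v hv
  by_contra hv0
  have key := norm_mulSqrt ω a b v
  rw [hv] at key
  exact mul_ne_zero h (sq_sub_mul_sq_ne_zero hω hv0) (by simpa using key.symm)

open Polynomial in
lemma exists_not_isSquare_sq_sub_mul_sq [Finite F] {ω : F} (hω : ¬ IsSquare ω) :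
    ∃ a b : F, ¬ IsSquare (a ^ 2 - ω * b ^ 2) := by
  have := Fintype.ofFinite F
  have hω0 : ω ≠ 0 := by rintro rfl; simp at hω
  have hchar : ringChar F ≠ 2 := fun h => hω (FiniteField.isSquare_of_char_two h ω)
  obtain ⟨a, b, hab⟩ := FiniteField.exists_root_sum_quadratic
    (f := (X ^ 2 : F[X])) (g := C (-ω) * X ^ 2 + C 0 * X + C (-ω)) (degree_X_pow 2)
    (degree_quadratic (neg_ne_zero.2 hω0)) (FiniteField.odd_card_of_char_ne_two hchar)
  refine ⟨a, b, ?_⟩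
  have e : a ^ 2 - ω * b ^ 2 = ω := by
    simp at hab
    linear_combination hab
  rwa [e]

/-- The lines of `F²` at whose nonzero vectors the value of `x² - ω y²` satisfies `P`. -/
def linesWithValues (ω : F) (P : F → Prop) : Set (Submodule F (Fin 2 → F)) :=
  {L | Module.finrank F L = 1 ∧ ∀ v ∈ L, v ≠ 0 → P (v 0 ^ 2 - ω * v 1 ^ 2)}

lemma ncard_linesWithValues_le [Finite F] {ω a b : F} (hω : ¬ IsSquare ω)
    (h : a ^ 2 - ω * b ^ 2 ≠ 0) {P R : F → Prop}
    (hPR : ∀ x, x ≠ 0 → P x → R ((a ^ 2 - ω * b ^ 2) * x)) :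
    (linesWithValues ω P).ncard ≤ (linesWithValues ω R).ncard := by
  have hinj := mulSqrt_injective hω h
  refine Set.ncard_le_ncard_of_injOn (Submodule.map (mulSqrt ω a b)) ?_
    (Submodule.map_injective_of_injective hinj).injOn (Set.toFinite _)
  rintro L ⟨hL, hP⟩
  refine ⟨(Submodule.equivMapOfInjective _ hinj L).finrank_eq.symm.trans hL, ?_⟩
  rintro _ ⟨v, hv, rfl⟩ hv0
  have hv1 : v ≠ 0 := by rintro rfl; simp at hv0
  rw [norm_mulSqrt]
  exact hPR _ (sq_sub_mul_sq_ne_zero hω hv1) (hP v hv hv1)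

lemma linesWithValues_union (ω : F) :
    linesWithValues ω IsSquare ∪ linesWithValues ω (¬ IsSquare ·) =
      {L : Submodule F (Fin 2 → F) | Module.finrank F L = 1} := by
  ext L
  refine ⟨fun h => h.elim And.left And.left, fun hL => ?_⟩
  obtain ⟨⟨w, hwL⟩, hw0, hw⟩ := finrank_eq_one_iff'.1 hL
  have key : ∀ v ∈ L, v ≠ 0 → (IsSquare (v 0 ^ 2 - ω * v 1 ^ 2) ↔
      IsSquare (w 0 ^ 2 - ω * w 1 ^ 2)) := by
    intro v hv hv0
    obtain ⟨c, hc⟩ := hw ⟨v, hv⟩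
    obtain rfl : c • w = v := congrArg Subtype.val hc
    have hc0 : c ≠ 0 := by rintro rfl; simp at hv0
    have e : (c • w) 0 ^ 2 - ω * (c • w) 1 ^ 2 = c ^ 2 * (w 0 ^ 2 - ω * w 1 ^ 2) := by
      simp; ring
    rw [e]
    refine ⟨fun ⟨r, hr⟩ => ⟨r / c, ?_⟩, (IsSquare.sq c).mul⟩
    field_simp
    linear_combination hr
  by_cases hs : IsSquare (w 0 ^ 2 - ω * w 1 ^ 2)
  · exact Or.inl ⟨hL, fun v hv hv0 => (key v hv hv0).2 hs⟩
  · exact Or.inr ⟨hL, fun v hv hv0 => (key v hv hv0).not.2 hs⟩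

lemma linesWithValues_disjoint (ω : F) (P : F → Prop) :
    Disjoint (linesWithValues ω P) (linesWithValues ω (¬ P ·)) := by
  rw [Set.disjoint_left]
  rintro L ⟨hL, hP⟩ ⟨-, hN⟩
  obtain ⟨⟨w, hwL⟩, hw0, -⟩ := finrank_eq_one_iff'.1 hL
  have hw : w ≠ 0 := by simpa using hw0
  exact hN w hwL hw (hP w hwL hw)

lemma ncard_lines [Finite F] :
    {L : Submodule F (Fin 2 → F) | Module.finrank F L = 1}.ncard = Nat.card F + 1 := by
  rw [← Projectivization.card_of_finrank_two F (Fin 2 → F) (by simp)]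
  exact (Nat.card_congr (Projectivization.equivSubmodule F (Fin 2 → F))).symm

lemma isSquare_mul_of_not_isSquare [Finite F] {x y : F} (hx : ¬ IsSquare x) (hy : ¬ IsSquare y) :
    IsSquare (x * y) := by
  classical
  have := Fintype.ofFinite F
  have h0 : x * y ≠ 0 := by
    apply mul_ne_zero <;> rintro rfl <;> simp at hx hy
  rw [← quadraticChar_one_iff_isSquare h0, map_mul,
    quadraticChar_neg_one_iff_not_isSquare.2 hx, quadraticChar_neg_one_iff_not_isSquare.2 hy]
  norm_num

theorem ncard_linesWithValues [Finite F] {ω : F} (hω : ¬ IsSquare ω) :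
    2 * (linesWithValues ω IsSquare).ncard = Nat.card F + 1 ∧
      2 * (linesWithValues ω (¬ IsSquare ·)).ncard = Nat.card F + 1 := by
  obtain ⟨a, b, hab⟩ := exists_not_isSquare_sq_sub_mul_sq hω
  have hab0 : a ^ 2 - ω * b ^ 2 ≠ 0 := fun h => hab (by simp [h])
  have hle := ncard_linesWithValues_le (P := IsSquare) (R := (¬ IsSquare ·)) hω hab0
    fun x hx hs hm => hab (by simpa [hx] using hm.div hs)
  have hge := ncard_linesWithValues_le (P := (¬ IsSquare ·)) (R := IsSquare) hω hab0
    fun x _ hs => isSquare_mul_of_not_isSquare hab hs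
  have hsum := Set.ncard_union_eq (linesWithValues_disjoint ω IsSquare)
    (Set.toFinite _) (Set.toFinite _)
  rw [linesWithValues_union, ncard_lines] at hsum
  lia

end AnisotropicPlane

/-- For `q` an odd prime and `ω` a non-square unit of `ℤ/qℤ`, the anisotropic plane
`A = !![1,0;0,-ω]` over `ℤ/qℤ` contains exactly `(q+1)/2` lines representing only
nonzero squares and exactly `(q+1)/2` lines representing only non-squares. -/
theorem anisotropic_lines_square_count (q : ℕ) (hq : q.Prime) (hodd : Odd q)
    (ω : ZMod q) (hω0 : ω ≠ 0) (hω : ¬ IsSquare ω) :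
    Set.ncard {L : Submodule (ZMod q) (Fin 2 → ZMod q) |
      Module.finrank (ZMod q) L = 1 ∧ ∀ v ∈ L, v ≠ 0 →
        IsSquare (v ⬝ᵥ (!![1, 0; 0, -ω] : Matrix (Fin 2) (Fin 2) (ZMod q)).mulVec v) ∧
          v ⬝ᵥ (!![1, 0; 0, -ω] : Matrix (Fin 2) (Fin 2) (ZMod q)).mulVec v ≠ 0}
      = (q + 1) / 2 ∧
    Set.ncard {L : Submodule (ZMod q) (Fin 2 → ZMod q) |
      Module.finrank (ZMod q) L = 1 ∧ ∀ v ∈ L, v ≠ 0 →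
        ¬ IsSquare (v ⬝ᵥ (!![1, 0; 0, -ω] : Matrix (Fin 2) (Fin 2) (ZMod q)).mulVec v)}
      = (q + 1) / 2 := by
  have : Fact q.Prime := ⟨hq⟩
  obtain ⟨hS, hN⟩ := ncard_linesWithValues hω
  rw [Nat.card_zmod] at hS hN
  simp only [dotProduct_diag_mulVec]
  refine ⟨?_, by unfold linesWithValues at hN; lia⟩
  have e : {L : Submodule (ZMod q) (Fin 2 → ZMod q) |
      Module.finrank (ZMod q) L = 1 ∧ ∀ v ∈ L, v ≠ 0 →
        IsSquare (v 0 ^ 2 - ω * v 1 ^ 2) ∧ v 0 ^ 2 - ω * v 1 ^ 2 ≠ 0} =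
      linesWithValues ω IsSquare :=
    Set.ext fun L => and_congr_right fun _ => forall₃_congr fun v _ hv =>
      and_iff_left (sq_sub_mul_sq_ne_zero hω hv)
  rw [e]
  lia
end

section
/- Let q be an odd prime and α an integer with q ∤ α. Let γ be a 4×4 integer symplectic matrix with 2×2 block decomposition γ = [[A,B],[C,D]], where every entry of C is divisible by q². Let M₀ be a diagonal 2×2 integer matrix with M₀ ≡ q·diag(1,α) (mod q²), and set M = M₀A + C and N = M₀B + D. Then every entry of M is divisible by q, and det(M/q)·det(N) ≡ α (mod q). -/
open Matrix

/-- A matrix all of whose entries are divisible by `a` is `a` times a matrix. -/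
lemma Matrix.exists_eq_smul_of_forall_dvd {m n R : Type*} [Semigroup R] {a : R}
    {X : Matrix m n R} (h : ∀ i j, a ∣ X i j) : ∃ Y : Matrix m n R, X = a • Y := by
  choose Y hY using h
  exact ⟨Matrix.of Y, Matrix.ext hY⟩

/-- The relation `AᵀD - CᵀB = 1` between the blocks of a symplectic matrix. -/
lemma Matrix.transpose_mul_sub_transpose_mul_eq_one_of_symplectic {n R : Type*} [Fintype n]
    [DecidableEq n] [CommRing R] {A B C D : Matrix n n R}
    (h : (fromBlocks A B C D)ᵀ * fromBlocks (0 : Matrix n n R) 1 (-1) 0 * fromBlocks A B C D =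
      fromBlocks (0 : Matrix n n R) 1 (-1) 0) :
    Aᵀ * D - Cᵀ * B = 1 := by
  rw [fromBlocks_transpose, fromBlocks_multiply, fromBlocks_multiply, fromBlocks_inj] at h
  have h₁₂ := h.2.1
  simp only [mul_zero, mul_neg, mul_one, zero_add, add_zero, neg_mul] at h₁₂
  rw [← h₁₂]
  abel

/-- Integer matrices that differ by a multiple of `a` have determinants congruent mod `a`. -/
lemma Matrix.det_add_smul_modEq {n : Type*} [Fintype n] [DecidableEq n] (a : ℤ)
    (X Y : Matrix n n ℤ) : (X + a • Y).det ≡ X.det [ZMOD a] := by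
  refine (Int.modEq_iff_dvd.2 ?_).symm
  rw [← Ideal.mem_span_singleton, ← Ideal.Quotient.mk_eq_mk_iff_sub_mem, RingHom.map_det,
    RingHom.map_det]
  congr 1
  ext i j
  refine (Ideal.Quotient.mk_eq_mk_iff_sub_mem _ _).2 (Ideal.mem_span_singleton.2 ⟨Y i j, ?_⟩)
  rw [add_apply, add_sub_cancel_left, smul_apply, smul_eq_mul]

/-- Part (c) of Proposition 5.1: let `γ = [[A,B],[C,D]]` be an integral symplectic
matrix with `q² ∣ C`, and let `M₀` be diagonal with `M₀ ≡ q·diag(1,α) (mod q²)` where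
`q ∤ α`.  Setting `M = M₀A + C` and `N = M₀B + D`, every entry of `M` is divisible by
`q`, and `det(M/q)·det(N) ≡ α (mod q)`. -/
theorem q_type_zero_two_alpha (q : ℕ) (hq : q.Prime) (hodd : Odd q)
    (α : ℤ) (hα : ¬ (q : ℤ) ∣ α)
    (A B C D : Matrix (Fin 2) (Fin 2) ℤ)
    (hsymp : (fromBlocks A B C D)ᵀ *
        fromBlocks (0 : Matrix (Fin 2) (Fin 2) ℤ) 1 (-1) 0 * fromBlocks A B C D =
      fromBlocks (0 : Matrix (Fin 2) (Fin 2) ℤ) 1 (-1) 0)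
    (hC : ∀ i j, ((q : ℤ) ^ 2) ∣ C i j)
    (M₀ : Matrix (Fin 2) (Fin 2) ℤ)
    (hM₀diag : ∃ d : Fin 2 → ℤ, M₀ = Matrix.diagonal d)
    (hM₀ : ∀ i j, ((q : ℤ) ^ 2) ∣ (M₀ - (q : ℤ) • Matrix.diagonal ![1, α]) i j)
    (M N : Matrix (Fin 2) (Fin 2) ℤ)
    (hM : M = M₀ * A + C) (hN : N = M₀ * B + D) :
    (∀ i j, (q : ℤ) ∣ M i j) ∧
      ∀ M' : Matrix (Fin 2) (Fin 2) ℤ, M = (q : ℤ) • M' →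
        M'.det * N.det ≡ α [ZMOD q] := by
  obtain ⟨C', rfl⟩ := exists_eq_smul_of_forall_dvd hC
  obtain ⟨E, hE⟩ := exists_eq_smul_of_forall_dvd hM₀
  obtain rfl := sub_eq_iff_eq_add'.1 hE
  set Δ : Matrix (Fin 2) (Fin 2) ℤ := diagonal ![1, α] with hΔ
  have hMq : M = (q : ℤ) • (Δ * A + (q : ℤ) • (E * A + C')) := by
    rw [hM]
    simp only [add_mul, smul_mul_assoc, smul_add, smul_smul, pow_two]
    abel
  refine ⟨fun i j => ⟨_, congrFun (congrFun hMq i) j⟩, fun M' hM' => ?_⟩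
  have hM'eq : M' = Δ * A + (q : ℤ) • (E * A + C') :=
    smul_right_injective _ (Int.natCast_ne_zero.2 hq.ne_zero) (hM'.symm.trans hMq)
  have hNeq : N = D + (q : ℤ) • ((Δ + (q : ℤ) • E) * B) := by
    rw [hN]
    simp only [add_mul, smul_mul_assoc, smul_add, smul_smul, pow_two]
    abel
  have hAD : Aᵀ * D = 1 + (q : ℤ) • ((q : ℤ) • (C'ᵀ * B)) := by
    rw [← transpose_mul_sub_transpose_mul_eq_one_of_symplectic hsymp, transpose_smul,
      smul_mul_assoc, smul_smul, pow_two, sub_add_cancel]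
  have hdetAD : A.det * D.det ≡ 1 [ZMOD q] := by
    rw [← det_transpose A, ← det_mul, hAD, ← det_one (n := Fin 2) (R := ℤ)]
    exact det_add_smul_modEq _ _ _
  have hdetΔ : Δ.det = α := by simp [hΔ]
  calc M'.det * N.det ≡ (Δ * A).det * D.det [ZMOD q] := by
        rw [hM'eq, hNeq]
        exact (det_add_smul_modEq _ _ _).mul (det_add_smul_modEq _ _ _)
    _ = α * (A.det * D.det) := by rw [det_mul, hdetΔ, mul_assoc]
    _ ≡ α * 1 [ZMOD q] := hdetAD.mul_left α
    _ = α := mul_one α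
end

section
/- Let q be an odd prime, k an integer, and Δ₀ a positive odd integer divisible by q with q ∤ (Δ₀/q), such that (-1)ᵏΔ₀ ≡ 1 (mod 4). Let e be an integer for which there exists an integer u with q ∤ u and e ≡ (-1)^(k-1)·(Δ₀/q)·u² (mod q). Then the Legendre symbol (e/q) equals the Jacobi symbol (q/(Δ₀/q)). -/
open NumberTheorySymbols in
/-- Quadratic reciprocity for odd `m` and `q`, the sign being absorbed into the numerator:
if `s = ±1` satisfies `s * (q * m) ≡ 1 (mod 4)`, then `J(-s * m | q) = J(q | m)`. -/
theorem jacobiSym_neg_unit_mul_eq {q m : ℕ} (hq : Odd q) (hm : Odd m) (s : ℤˣ)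
    (h : (s : ℤ) * ((q * m : ℕ) : ℤ) ≡ 1 [ZMOD 4]) :
    J(-(s : ℤ) * m | q) = J(q | m) := by
  have hq4 := Nat.odd_mod_four_iff.mp (Nat.odd_iff.mp hq)
  have hm4 := Nat.odd_mod_four_iff.mp (Nat.odd_iff.mp hm)
  have hqm : q * m % 4 = (q % 4) * (m % 4) % 4 := Nat.mul_mod q m 4
  unfold Int.ModEq at h
  rcases hq4 with hq4 | hq4
  · rw [jacobiSym.quadratic_reciprocity_one_mod_four hq4 hm]
    rcases Int.units_eq_one_or s with rfl | rfl
    · simp [jacobiSym.neg _ hq, ZMod.χ₄_nat_one_mod_four hq4]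
    · simp
  · rcases Int.units_eq_one_or s with rfl | rfl
    · have hm3 : m % 4 = 3 := by
        rcases hm4 with hm4 | hm4
        · rw [hq4, hm4] at hqm
          simp only [Units.val_one] at h
          omega
        · exact hm4
      simp [jacobiSym.neg _ hq, ZMod.χ₄_nat_three_mod_four hq4,
        jacobiSym.quadratic_reciprocity_three_mod_four hq4 hm3]
    · have hm1 : m % 4 = 1 := by
        rcases hm4 with hm4 | hm4
        · exact hm4
        · rw [hq4, hm4] at hqm
          simp only [Units.val_neg, Units.val_one] at h
          omega
      simp [jacobiSym.quadratic_reciprocity_one_mod_four hm1 hq]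

/-- Arithmetic core of Lemma 4.1(1): with `q` an odd prime, `Δ₀` a positive odd
integer divisible by `q` with `q ∤ Δ₀/q` and `(-1)ᵏΔ₀ ≡ 1 (mod 4)`, and `e` an
integer with `e ≡ (-1)^(k-1)·(Δ₀/q)·u² (mod q)` for some `u` prime to `q`, the
Legendre symbol `(e/q)` equals the Jacobi symbol `(q/(Δ₀/q))`. -/
theorem legendre_eq_jacobi_of_discriminant (q : ℕ) [Fact q.Prime] (hodd : Odd q)
    (k : ℤ) (Δ₀ : ℕ) (hΔpos : 0 < Δ₀) (hΔodd : Odd Δ₀) (hqΔ : q ∣ Δ₀)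
    (hq' : ¬ q ∣ (Δ₀ / q))
    (hcong : (((-1 : ℤˣ) ^ k : ℤˣ) : ℤ) * (Δ₀ : ℤ) ≡ 1 [ZMOD 4])
    (e : ℤ)
    (he : ∃ u : ℤ, ¬ (q : ℤ) ∣ u ∧
      e ≡ (((-1 : ℤˣ) ^ (k - 1) : ℤˣ) : ℤ) * ((Δ₀ / q : ℕ) : ℤ) * u ^ 2 [ZMOD q]) :
    legendreSym q e = jacobiSym (q : ℤ) (Δ₀ / q) := by
  obtain ⟨u, hu, he⟩ := he
  obtain ⟨m, rfl⟩ := hqΔ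
  have hq : q.Prime := Fact.out
  rw [Nat.mul_div_cancel_left m hq.pos] at he ⊢
  have hm : Odd m := (Nat.odd_mul.mp hΔodd).2
  have hsign : (((-1 : ℤˣ) ^ (k - 1) : ℤˣ) : ℤ) = -(((-1 : ℤˣ) ^ k : ℤˣ) : ℤ) := by
    simp [zpow_sub_one]
  have hu' : u.gcd q = 1 := by
    rw [Int.gcd_comm]
    exact Int.isCoprime_iff_gcd_eq_one.mp
      ((Nat.prime_iff_prime_int.mp hq).coprime_iff_not_dvd.mpr hu)
  rw [jacobiSym.legendreSym.to_jacobiSym, jacobiSym.mod_left' he, jacobiSym.mul_left,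
    jacobiSym.sq_one' hu', mul_one, hsign]
  exact jacobiSym_neg_unit_mul_eq hodd hm _ hcong
end
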